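/- Let l ≥ 2 and m ≥ 2 be integers. For every integer H with H ≤ (l−1)m²/4 there exists a word W over the alphabet {1,…,l} that is not m-divisible and that cannot be written as a concatenation W = u₁^{k₁}·u₂^{k₂}·…·u_r^{k_r} with r ≤ H, where each uᵢ is a word of length at most m−1 and each kᵢ ≥ 1. Equivalently, the height of the set of non-m-divisible words over the alphabet {1,…,l}, with respect to the set of words of length at most m−1, is at least (l−1)m²/4 + 1. -/

import Mathlib

/-- `u` is lexicographically greater than `v`: at the first position where they
differ, `u` has the larger letter (words where one is a prefix of the other are
incomparable). -/
def WordGt {α : Type*} [LinearOrder α] (u v : List α) : Prop :=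
  List.Lex (· < ·) v u ∧ ¬ v <+: u

/-- `wpow z k` is the concatenation of `k` copies of the word `z`. -/
def wpow {α : Type*} (z : List α) : ℕ → List α
  | 0 => []
  | k + 1 => z ++ wpow z k

/-- A word is noncyclic (primitive) if it is nonempty and is not a proper power. -/
def Noncyclic {α : Type*} (z : List α) : Prop :=
  z ≠ [] ∧ ∀ (v : List α) (k : ℕ), 2 ≤ k → z ≠ wpow v k

/-- `W` is `n`-divisible: `W = W₀W₁⋯Wₙ` with `W₁,…,Wₙ` nonempty and in strictly
decreasing lexicographic order. -/
def NDivisible {α : Type*} [LinearOrder α] (W : List α) (n : ℕ) : Prop :=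
  ∃ (W₀ : List α) (f : Fin n → List α),
    W = W₀ ++ (List.ofFn f).flatten ∧
    (∀ i, f i ≠ []) ∧
    (∀ i j, i < j → WordGt (f i) (f j))

/-- `W` is strongly `n`-divisible over the set of words `Z` (with boundary `2n`):
it is `n`-divisible with each `Wᵢ` (`1 ≤ i ≤ n`) beginning with `zᵢ^{2n}` for
pairwise distinct `z₁,…,zₙ ∈ Z`. -/
def StronglyNDivisible {α : Type*} [LinearOrder α] (W : List α) (n : ℕ)
    (Z : Set (List α)) : Prop :=
  ∃ (W₀ : List α) (f : Fin n → List α) (z : Fin n → List α),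
    W = W₀ ++ (List.ofFn f).flatten ∧
    (∀ i, f i ≠ []) ∧
    (∀ i j, i < j → WordGt (f i) (f j)) ∧
    (∀ i, z i ∈ Z ∧ wpow (z i) (2 * n) <+: f i) ∧
    Function.Injective z

/-- `u` occurs as a subword of `W` starting at position `p`. -/
def OccursAt {α : Type*} (W u : List α) (p : ℕ) : Prop :=
  ∃ pre suf : List α, pre.length = p ∧ W = pre ++ u ++ suf

/-- Lexicographic comparison of words in which the end of a word is larger than every letter. -/
def EndLe : List ℕ → List ℕ → Prop
  | _, [] => True
  | [], _ :: _ => False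
  | a :: u, b :: v => a < b ∨ a = b ∧ EndLe u v

namespace EndLe

@[simp] theorem nil_right (u : List ℕ) : EndLe u [] := by cases u <;> trivial

theorem refl (u : List ℕ) : EndLe u u := by
  induction u with
  | nil => trivial
  | cons a u ih => exact Or.inr ⟨rfl, ih⟩

theorem trans : ∀ {u v w : List ℕ}, EndLe u v → EndLe v w → EndLe u w
  | _, _, [], _, _ => nil_right _
  | _, [], _ :: _, _, h => h.elim
  | [], _ :: _, _ :: _, h, _ => h.elim
  | a :: u, b :: v, c :: w, h, h' => by
    rcases h with h | ⟨rfl, h⟩ <;> rcases h' with h' | ⟨rfl, h'⟩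
    · exact Or.inl (h.trans h')
    · exact Or.inl h
    · exact Or.inl h'
    · exact Or.inr ⟨rfl, h.trans h'⟩

theorem append_left (w : List ℕ) {u v : List ℕ} (h : EndLe u v) : EndLe (w ++ u) (w ++ v) := by
  induction w with
  | nil => exact h
  | cons a w ih => exact Or.inr ⟨rfl, ih⟩

/-- A longer run of a small letter beats a shorter run followed by a larger letter. -/
theorem replicate_of_lt {c d y z : ℕ} (u v : List ℕ) (hdc : d < c) (hyz : y < z) :
    EndLe (List.replicate c y ++ u) (List.replicate d y ++ z :: v) := by
  obtain ⟨e, rfl⟩ := Nat.exists_eq_add_of_lt hdc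
  rw [show d + e + 1 = d + (e + 1) by omega, List.replicate_add, List.append_assoc]
  exact append_left _ (Or.inl hyz)

theorem replicate_of_le {c d y : ℕ} {u v : List ℕ} (hcd : c ≤ d)
    (h : EndLe u (List.replicate (d - c) y ++ v)) :
    EndLe (List.replicate c y ++ u) (List.replicate d y ++ v) := by
  obtain ⟨e, rfl⟩ := Nat.exists_eq_add_of_le hcd
  rw [List.replicate_add, List.append_assoc]
  rw [Nat.add_sub_cancel_left] at h
  exact append_left _ h

/-- Words starting with runs of different letters are compared by these letters. -/
theorem replicate_lt_replicate {c d y z : ℕ} (u v : List ℕ) (hc : 0 < c) (hd : 0 < d)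
    (hyz : y < z) : EndLe (List.replicate c y ++ u) (List.replicate d z ++ v) := by
  obtain ⟨c, rfl⟩ := Nat.exists_eq_succ_of_ne_zero hc.ne'
  obtain ⟨d, rfl⟩ := Nat.exists_eq_succ_of_ne_zero hd.ne'
  exact Or.inl hyz

/-- A longer run of `y` beats a shorter run followed by a nonempty run of a larger letter. -/
theorem replicate_of_lt' {c d y e z : ℕ} (u v : List ℕ) (hdc : d < c) (he : 0 < e)
    (hyz : y < z) :
    EndLe (List.replicate c y ++ u) (List.replicate d y ++ (List.replicate e z ++ v)) := by
  obtain ⟨e, rfl⟩ := Nat.exists_eq_succ_of_ne_zero he.ne'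
  exact replicate_of_lt _ _ hdc hyz

end EndLe

theorem WordGt.not_endLe {u v : List ℕ} (h : WordGt u v) (s t : List ℕ) :
    ¬ EndLe (u ++ s) (v ++ t) := by
  obtain ⟨hlex, hpre⟩ := h
  induction hlex with
  | nil => exact absurd List.nil_prefix hpre
  | rel hab =>
    rintro (h | ⟨h, -⟩)
    · exact absurd hab (by omega)
    · omega
  | cons _ ih =>
    rintro (h | ⟨-, h⟩)
    · exact lt_irrefl _ h
    · exact ih (fun hp => hpre (List.prefix_cons_inj _ |>.2 hp)) h

/-- Parameters of the word `lo^a hi^b`. -/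
@[ext] structure Block where
  lo : ℕ
  hi : ℕ
  a : ℕ
  b : ℕ

namespace Block

def word (f : Block) : List ℕ := List.replicate f.a f.lo ++ List.replicate f.b f.hi

/-- The blocks used in the construction: single letters `x`, the words `x^a (x+1)^b` of length
less than `m`, and the words `x (x+2)`. -/
def Valid (m : ℕ) (f : Block) : Prop :=
  (f.hi = f.lo ∧ f.a = 1 ∧ f.b = 0) ∨
    (1 ≤ f.a ∧ 1 ≤ f.b ∧ f.a + f.b < m ∧
      (f.hi = f.lo + 1 ∨ f.hi = f.lo + 2 ∧ f.a = 1 ∧ f.b = 1))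

/-- The order in which the blocks are arranged. -/
def Before (f g : Block) : Prop :=
  f.lo < g.lo ∨ f.lo = g.lo ∧ (f.hi < g.hi ∨ f.hi = g.hi ∧ (g.a < f.a ∨ g.a = f.a ∧ f.b ≤ g.b))

theorem Before.refl (f : Block) : f.Before f := by simp [Before]

/-- A function of the positions in a block that decreases along lexicographically decreasing
suffixes. -/
def rank (m : ℕ) (f : Block) (o : ℕ) : ℕ :=
  if o < f.a then o else if f.hi = f.lo + 2 then m - 2 else 2 * f.a + f.b - 1 - o

@[simp] theorem length_word (f : Block) : f.word.length = f.a + f.b := by simp [word]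

theorem drop_word_of_le (f : Block) {o : ℕ} (h : o ≤ f.a) (t : List ℕ) :
    f.word.drop o ++ t = List.replicate (f.a - o) f.lo ++ (List.replicate f.b f.hi ++ t) := by
  rw [word, List.drop_append_of_le_length (by simpa using h), List.drop_replicate,
    List.append_assoc]

theorem drop_word_of_ge (f : Block) {o : ℕ} (h : f.a ≤ o) (t : List ℕ) :
    f.word.drop o ++ t = List.replicate (f.a + f.b - o) f.hi ++ t := by
  rw [word, List.drop_append, List.drop_replicate, List.drop_replicate, List.length_replicate,
    Nat.sub_eq_zero_of_le h, List.replicate_zero, List.nil_append]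
  congr 2
  omega

theorem word_append (f : Block) (t : List ℕ) :
    f.word ++ t = List.replicate f.a f.lo ++ (List.replicate f.b f.hi ++ t) := by
  simp [word]

theorem Valid.rank_lt {m : ℕ} {f : Block} (hm : 2 ≤ m) (hf : f.Valid m) {o : ℕ}
    (ho : o < f.a + f.b) : f.rank m o < m - 1 := by
  unfold Valid at hf
  unfold rank
  split_ifs <;> omega

/-- The words of valid blocks are Lyndon words. -/
theorem Valid.word_append_le_drop {m : ℕ} {f : Block} (hf : f.Valid m) {o : ℕ}
    (ho : o < f.a + f.b) (t : List ℕ) : EndLe (f.word ++ t) (f.word.drop o ++ t) := by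
  rcases Nat.eq_zero_or_pos o with rfl | hpos
  · exact EndLe.refl _
  unfold Valid at hf
  rw [word_append]
  rcases lt_or_ge o f.a with h | h
  · rw [drop_word_of_le f h.le]
    exact EndLe.replicate_of_lt' _ _ (by omega) (by omega) (by omega)
  · rw [drop_word_of_ge f h]
    exact EndLe.replicate_lt_replicate _ _ (by omega) (by omega) (by omega)

theorem Before.word_append_word_le {m : ℕ} {f g : Block} (hf : f.Valid m) (hg : g.Valid m)
    (h : f.Before g) (hne : f ≠ g) (t : List ℕ) :
    EndLe (f.word ++ (g.word ++ t)) (g.word ++ t) := by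
  have hne' : ¬ (f.lo = g.lo ∧ f.hi = g.hi ∧ f.a = g.a ∧ f.b = g.b) := by
    rintro ⟨h1, h2, h3, h4⟩
    exact hne (Block.ext h1 h2 h3 h4)
  unfold Valid at hf hg
  rcases h with h | ⟨hlo, h⟩
  · rw [word_append f, word_append g]
    exact EndLe.replicate_lt_replicate _ _ (by omega) (by omega) h
  rcases lt_or_ge g.a f.a with ha | ha
  · rw [word_append f, word_append g, hlo]
    exact EndLe.replicate_of_lt' _ _ ha (by omega) (by omega)
  by_cases hsingle : f.hi = f.lo
  · have hb : f.b = 0 := by omega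
    rw [word_append f, hb, hsingle, word_append g, hlo, List.replicate_zero, List.nil_append,
      ← List.append_assoc, ← List.replicate_add]
    exact EndLe.replicate_of_lt' _ _ (by omega) (by omega) (by omega)
  have ha' : g.a = f.a := by omega
  rw [word_append f, word_append g, hlo, ha']
  apply EndLe.append_left
  rcases h with h | ⟨hhi, h⟩
  · exact EndLe.replicate_lt_replicate _ _ (by omega) (by omega) h
  · rw [hhi]
    apply EndLe.replicate_of_le (by omega)
    exact EndLe.replicate_lt_replicate _ _ (by omega) (by omega) (by omega)

/-- The concatenation of the words of a list of blocks. -/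
def cat (L : List Block) : List ℕ := L.flatMap word

@[simp] theorem cat_nil : cat [] = [] := rfl

@[simp] theorem cat_cons (f : Block) (L : List Block) : cat (f :: L) = f.word ++ cat L := rfl

@[simp] theorem cat_append (L M : List Block) : cat (L ++ M) = cat L ++ cat M := by
  simp [cat]

theorem word_append_cat_le {m : ℕ} (f : Block) (M : List Block)
    (hp : (f :: M).Pairwise Before) (hv : ∀ g ∈ f :: M, g.Valid m) :
    EndLe (f.word ++ cat M) (cat M) := by
  induction M with
  | nil => simp
  | cons g M ih =>
    by_cases hfg : f = g
    · subst hfg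
      exact EndLe.append_left _ (ih (List.pairwise_cons.1 hp).2 fun g hg => hv g (by simp_all))
    · exact Before.word_append_word_le (hv f (by simp)) (hv g (by simp))
        ((List.pairwise_cons.1 hp).1 g (by simp)) hfg _

theorem cat_le_cat_of_append {m : ℕ} (L M : List Block)
    (hp : (L ++ M).Pairwise Before) (hv : ∀ g ∈ L ++ M, g.Valid m) :
    EndLe (cat (L ++ M)) (cat M) := by
  induction L with
  | nil => exact EndLe.refl _
  | cons f L ih =>
    exact (word_append_cat_le f (L ++ M) hp hv).trans
      (ih (List.pairwise_cons.1 hp).2 fun g hg => hv g (by simp_all))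

/-- A suffix starting at a block boundary is at most every later suffix. -/
theorem cat_le_drop_append {m : ℕ} (L M : List Block) (g : Block)
    (hp : (L ++ g :: M).Pairwise Before) (hv : ∀ g' ∈ L ++ g :: M, g'.Valid m)
    {o : ℕ} (ho : o < g.a + g.b) :
    EndLe (cat (L ++ g :: M)) (g.word.drop o ++ cat M) :=
  (cat_le_cat_of_append L (g :: M) hp hv).trans
    ((hv g (by simp)).word_append_le_drop ho _)

theorem le_or_rank_lt_of_same {m : ℕ} {f : Block} (hf : f.Valid m) {p q : ℕ}
    (hpq : p < q) (hq : q < f.a + f.b) (t : List ℕ) :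
    EndLe (f.word.drop p ++ t) (f.word.drop q ++ t) ∨ f.rank m q < f.rank m p := by
  unfold Valid at hf
  rcases lt_or_ge p f.a with hpa | hpa
  · left
    rw [drop_word_of_le f hpa.le]
    rcases lt_or_ge q f.a with hqa | hqa
    · rw [drop_word_of_le f hqa.le]
      exact EndLe.replicate_of_lt' _ _ (by omega) (by omega) (by omega)
    · rw [drop_word_of_ge f hqa]
      exact EndLe.replicate_lt_replicate _ _ (by omega) (by omega) (by omega)
  · right
    unfold rank
    split_ifs <;> omega

theorem le_or_rank_lt_of_before {m : ℕ} {f g : Block} {L M : List Block}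
    (hp : (f :: (L ++ g :: M)).Pairwise Before) (hv : ∀ g' ∈ f :: (L ++ g :: M), g'.Valid m)
    {p q : ℕ} (hpf : p < f.a + f.b) (hqg : q < g.a + g.b) :
    EndLe (f.word.drop p ++ cat (L ++ g :: M)) (g.word.drop q ++ cat M) ∨
      g.rank m q < f.rank m p := by
  rcases Nat.eq_zero_or_pos p with rfl | hp0
  · exact Or.inl (cat_le_drop_append (f :: L) M g hp hv hqg)
  have hfg : f.Before g := (List.pairwise_cons.1 hp).1 g (by simp)
  have hf := hv f (by simp)
  have hg := hv g (by simp)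
  have hp' := (List.pairwise_cons.1 hp).2
  have hv' : ∀ g' ∈ L ++ g :: M, g'.Valid m := fun g' h => hv g' (List.mem_cons_of_mem _ h)
  have hB {o : ℕ} (ho : o < g.a + g.b) := cat_le_drop_append L M g hp' hv' ho
  have hT : EndLe (cat (L ++ g :: M)) (cat M) := by
    have := cat_le_cat_of_append (L ++ [g]) M (by simpa using hp') (by simpa using hv')
    simpa using this
  generalize cat (L ++ g :: M) = T at *
  have hhi {e : ℕ} (he : e ≤ g.b) : EndLe T (List.replicate e g.hi ++ cat M) := by
    rcases Nat.eq_zero_or_pos e with rfl | he0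
    · exact hT
    · have := hB (o := g.a + g.b - e) (by omega)
      rwa [drop_word_of_ge g (by omega), show g.a + g.b - (g.a + g.b - e) = e by omega] at this
  have hlo {e : ℕ} (he : e ≤ g.a) (hb : 0 < g.b) :
      EndLe T (List.replicate e g.lo ++ (List.replicate g.b g.hi ++ cat M)) := by
    have := hB (o := g.a - e) (by omega)
    rwa [drop_word_of_le g (by omega), show g.a - (g.a - e) = e by omega] at this
  clear hp hv hp' hv' hB
  unfold Valid at hf hg
  unfold Before at hfg
  rcases Nat.eq_zero_or_pos q with rfl | hq0
  · right
    unfold rank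
    split_ifs <;> omega
  rcases lt_or_ge p f.a with hpa | hpa
  · rw [drop_word_of_le f hpa.le]
    rcases lt_or_ge q g.a with hqa | hqa
    · rw [drop_word_of_le g hqa.le]
      by_cases hx : f.lo < g.lo
      · exact Or.inl (EndLe.replicate_lt_replicate _ _ (by omega) (by omega) hx)
      have hx : f.lo = g.lo := by omega
      have hy : f.hi = g.hi := by omega
      rw [hx]
      rcases lt_trichotomy (g.a - q) (f.a - p) with hc | hc | hc
      · exact Or.inl (EndLe.replicate_of_lt' _ _ hc (by omega) (by omega))
      · by_cases ha : g.a = f.a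
        · left
          rw [hc, hy]
          apply EndLe.append_left
          exact EndLe.replicate_of_le (by omega) (hhi (by omega))
        · right
          unfold rank
          split_ifs <;> omega
      · right
        unfold rank
        split_ifs <;> omega
    · rw [drop_word_of_ge g hqa]
      exact Or.inl (EndLe.replicate_lt_replicate _ _ (by omega) (by omega) (by omega))
  · rw [drop_word_of_ge f hpa]
    rcases lt_or_ge q g.a with hqa | hqa
    · rw [drop_word_of_le g hqa.le]
      by_cases hr : g.rank m q < f.rank m p
      · exact Or.inr hr
      left
      unfold rank at hr
      rw [if_pos hqa, if_neg (by omega)] at hr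
      rcases lt_or_ge f.hi g.lo with hy | hy
      · exact EndLe.replicate_lt_replicate _ _ (by omega) (by omega) hy
      have hy : f.hi = g.lo := by
        split_ifs at hr <;> omega
      rw [hy]
      rcases lt_or_ge (g.a - q) (f.a + f.b - p) with hc | hc
      · exact EndLe.replicate_of_lt' _ _ hc (by omega) (by omega)
      · exact EndLe.replicate_of_le hc (hlo (by omega) (by omega))
    · rw [drop_word_of_ge g hqa]
      rcases lt_or_ge f.hi g.hi with hy | hy
      · exact Or.inl (EndLe.replicate_lt_replicate _ _ (by omega) (by omega) hy)
      have hy : f.hi = g.hi := by omega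
      rcases lt_or_ge (g.a + g.b - q) (f.a + f.b - p) with hc | hc
      · right
        unfold rank
        split_ifs <;> omega
      · left
        rw [hy]
        exact EndLe.replicate_of_le hc (hhi (by omega))

/-- The rank of a position in the concatenation of a list of blocks. -/
def rankAt (m : ℕ) : List Block → ℕ → ℕ
  | [], _ => 0
  | f :: M, q => if q < f.a + f.b then f.rank m q else rankAt m M (q - (f.a + f.b))

theorem exists_block_of_lt_length (m : ℕ) (L : List Block) {q : ℕ} (hq : q < (cat L).length) :
    ∃ (L₁ : List Block) (g : Block) (L₂ : List Block) (o : ℕ), L = L₁ ++ g :: L₂ ∧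
      o < g.a + g.b ∧ (cat L).drop q = g.word.drop o ++ cat L₂ ∧ rankAt m L q = g.rank m o := by
  induction L generalizing q with
  | nil => simp at hq
  | cons f M ih =>
    rcases lt_or_ge q (f.a + f.b) with h | h
    · refine ⟨[], f, M, q, rfl, h, ?_, if_pos h⟩
      rw [cat_cons, List.drop_append_of_le_length (by simpa using h.le)]
    · rw [cat_cons, List.length_append, length_word] at hq
      obtain ⟨L₁, g, L₂, o, rfl, ho, hd, hr⟩ := ih (q := q - (f.a + f.b)) (by omega)
      refine ⟨f :: L₁, g, L₂, o, rfl, ho, ?_, ?_⟩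
      · rw [← hd, cat_cons, List.drop_append, List.drop_eq_nil_of_le (by simpa using h)]
        simp
      · rw [← hr, rankAt, if_neg (by omega)]

theorem rankAt_lt {m : ℕ} (hm : 2 ≤ m) (L : List Block) (hv : ∀ f ∈ L, f.Valid m) {q : ℕ}
    (hq : q < (cat L).length) : rankAt m L q < m - 1 := by
  obtain ⟨L₁, g, L₂, o, rfl, ho, -, hr⟩ := exists_block_of_lt_length m L hq
  exact hr ▸ (hv g (by simp)).rank_lt hm ho

theorem le_or_rankAt_lt {m : ℕ} (L : List Block) (hp : L.Pairwise Before)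
    (hv : ∀ f ∈ L, f.Valid m) {p q : ℕ} (hpq : p < q) (hq : q < (cat L).length) :
    EndLe ((cat L).drop p) ((cat L).drop q) ∨ rankAt m L q < rankAt m L p := by
  induction L generalizing p q with
  | nil => simp at hq
  | cons f M ih =>
    have hdrop {n : ℕ} (h : f.a + f.b ≤ n) :
        (cat (f :: M)).drop n = (cat M).drop (n - (f.a + f.b)) := by
      rw [cat_cons, List.drop_append, List.drop_eq_nil_of_le (by simpa using h)]
      simp
    have hdrop' {n : ℕ} (h : n < f.a + f.b) :
        (cat (f :: M)).drop n = f.word.drop n ++ cat M := by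
      rw [cat_cons, List.drop_append_of_le_length (by simpa using h.le)]
    have hlen : (cat (f :: M)).length = f.a + f.b + (cat M).length := by simp
    rcases lt_or_ge p (f.a + f.b) with hpf | hpf
    · rw [hdrop' hpf, rankAt, rankAt, if_pos hpf]
      rcases lt_or_ge q (f.a + f.b) with hqf | hqf
      · rw [hdrop' hqf, if_pos hqf]
        exact le_or_rank_lt_of_same (hv f (by simp)) hpq hqf _
      · rw [hdrop hqf, if_neg (by omega)]
        obtain ⟨L₁, g, L₂, o, rfl, ho, hd, hr⟩ :=
          exists_block_of_lt_length m M (q := q - (f.a + f.b)) (by omega)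
        rw [hd, hr]
        exact le_or_rank_lt_of_before hp hv hpf ho
    · rw [hdrop hpf, hdrop (by omega), rankAt, rankAt, if_neg (by omega), if_neg (by omega)]
      exact ih (List.pairwise_cons.1 hp).2 (fun g hg => hv g (List.mem_cons_of_mem _ hg))
        (by omega) (by omega)

end Block

/-- The factors of an `n`-divisible word start at increasing positions. -/
theorem NDivisible.exists_positions {W : List ℕ} {n : ℕ} (h : NDivisible W n) :
    ∃ p : Fin n → ℕ, (∀ i, p i < W.length) ∧ (∀ i j, i < j → p i < p j) ∧
      ∀ i j, i < j → ¬ EndLe (W.drop (p i)) (W.drop (p j)) := by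
  obtain ⟨W₀, f, rfl, hne, hgt⟩ := h
  have hsplit (i : Fin n) : (List.ofFn f).flatten = ((List.ofFn f).take i).flatten ++
      (f i ++ ((List.ofFn f).drop (i + 1)).flatten) := by
    conv_lhs => rw [← List.take_append_drop i (List.ofFn f)]
    rw [List.flatten_append, List.drop_eq_getElem_cons (by simp)]
    simp
  have hdrop (i : Fin n) : (W₀ ++ (List.ofFn f).flatten).drop
      (W₀ ++ ((List.ofFn f).take i).flatten).length =
        f i ++ ((List.ofFn f).drop (i + 1)).flatten := by
    conv_lhs => rw [hsplit i, ← List.append_assoc, List.drop_left]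
  refine ⟨fun i => (W₀ ++ ((List.ofFn f).take i).flatten).length, fun i => ?_, fun i j hij => ?_,
    fun i j hij => ?_⟩
  · have := List.length_pos_iff.2 (hne i)
    rw [hsplit i]
    simp only [List.length_append]
    omega
  · have hlen : ((List.ofFn f).take (i + 1)).flatten.length ≤
        ((List.ofFn f).take j).flatten.length :=
      (List.Sublist.flatten (List.take_prefix_take_left (by simp; omega)).sublist).length_le
    rw [List.take_add_one, List.flatten_append, List.length_append] at hlen
    have := List.length_pos_iff.2 (hne i)
    simp at hlen ⊢
    omega
  · simp only [hdrop]
    exact (hgt i j hij).not_endLe _ _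

theorem Block.not_nDivisible_cat {m : ℕ} (hm : 2 ≤ m) (L : List Block)
    (hp : L.Pairwise Block.Before) (hv : ∀ f ∈ L, f.Valid m) : ¬ NDivisible (Block.cat L) m := by
  intro h
  obtain ⟨p, hlt, hmono, hle⟩ := h.exists_positions
  have hanti (i j : Fin m) (hij : i < j) :
      Block.rankAt m L (p j) < Block.rankAt m L (p i) :=
    (Block.le_or_rankAt_lt L hp hv (hmono i j hij) (hlt j)).resolve_left (hle i j hij)
  let φ : Fin m → Fin (m - 1) := fun i => ⟨Block.rankAt m L (p i), Block.rankAt_lt hm L hv (hlt i)⟩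
  have hφ : Function.Injective φ := by
    intro i j hij
    have hij : Block.rankAt m L (p i) = Block.rankAt m L (p j) := congrArg Fin.val hij
    rcases lt_trichotomy i j with h | h | h
    · have := hanti i j h
      omega
    · exact h
    · have := hanti j i h
      omega
  have := Fintype.card_le_of_injective φ hφ
  simp at this
  omega

section Powers

variable {α : Type*}

theorem wpow_add (z : List α) (i j : ℕ) : wpow z (i + j) = wpow z i ++ wpow z j := by
  induction i with
  | zero => simp [wpow]
  | succ i ih => rw [Nat.succ_add, wpow, wpow, ih, List.append_assoc]

theorem length_wpow (z : List α) (k : ℕ) : (wpow z k).length = k * z.length := by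
  induction k with
  | zero => simp [wpow]
  | succ k ih => rw [wpow, List.length_append, ih]; ring

theorem map_wpow {β : Type*} (φ : α → β) (z : List α) (k : ℕ) :
    (wpow z k).map φ = wpow (z.map φ) k := by
  induction k with
  | zero => rfl
  | succ k ih => rw [wpow, wpow, List.map_append, ih]

theorem getElem?_wpow (z : List α) (k i : ℕ) (hi : i < k * z.length) :
    (wpow z k)[i]? = z[i % z.length]? := by
  induction k generalizing i with
  | zero => simp at hi
  | succ k ih =>
    rw [wpow]
    rcases lt_or_ge i z.length with h | h
    · rw [List.getElem?_append_left h, Nat.mod_eq_of_lt h]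
    · rw [Nat.succ_mul] at hi
      rw [List.getElem?_append_right h, ih _ (by omega), ← Nat.mod_eq_sub_mod h]

/-- A high power inside a concatenation of `n` words leaves a large power inside one of them. -/
theorem exists_wpow_infix_of_infix_flatten {z : List α} (hz : z ≠ []) {M : ℕ} (hM : 0 < M)
    (L : List (List α)) {K : ℕ} (hK : M * (L.length + 1) ≤ K) (h : wpow z K <:+: L.flatten) :
    ∃ e ∈ L, wpow z M <:+: e := by
  induction L generalizing K with
  | nil =>
    have := h.length_le
    rw [length_wpow] at this
    have hz' := List.length_pos_iff.2 hz
    simp only [List.flatten_nil, List.length_nil] at this hK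
    nlinarith
  | cons A L ih =>
    obtain ⟨s, t, hst⟩ := h
    rw [List.length_cons, Nat.mul_succ] at hK
    obtain ⟨K, rfl⟩ : ∃ K', K = M + K' := ⟨K - M, by omega⟩
    rw [wpow_add, List.flatten_cons,
      show s ++ (wpow z M ++ wpow z K) ++ t = (s ++ wpow z M) ++ (wpow z K ++ t) by simp,
      List.append_eq_append_iff] at hst
    rcases hst with ⟨c, hc, -⟩ | ⟨c, -, hc⟩
    · exact ⟨A, by simp, s, c, hc.symm⟩
    · obtain ⟨e, he, hi⟩ := ih (K := K) (by omega) ⟨c, t, by rw [List.append_assoc, hc]⟩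
      exact ⟨e, by simp [he], hi⟩

/-- If a sufficiently high power of `z` occurs in a power of `u`, then the periodic sequences
generated by `z` and by `u` agree up to a shift. -/
theorem exists_shift_of_wpow_infix {z u : List α} (hz : z ≠ []) (hu : u ≠ []) {M k : ℕ}
    (hM : u.length < M) (h : wpow z M <:+: wpow u k) :
    ∃ o, ∀ x, u[(o + x) % u.length]? = z[x % z.length]? := by
  obtain ⟨s, t, hst⟩ := h
  have hz' := List.length_pos_iff.2 hz
  have hu' := List.length_pos_iff.2 hu
  have hwin (x : ℕ) (hx : x < M * z.length) :
      u[(s.length + x) % u.length]? = z[x % z.length]? := by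
    have hlen := congrArg List.length hst
    simp only [List.length_append, length_wpow] at hlen
    rw [← getElem?_wpow u k _ (by omega), ← getElem?_wpow z M _ hx, ← hst,
      List.getElem?_append_left (by simp [length_wpow]; omega),
      List.getElem?_append_right (by omega), Nat.add_sub_cancel_left]
  have hbig : u.length + z.length ≤ M * z.length := by nlinarith
  have hper : Function.Periodic (fun x => u[(s.length + x) % u.length]?) z.length := by
    intro x
    have h1 := hwin (x % u.length + z.length) (by have := Nat.mod_lt x hu'; omega)
    have h2 := hwin (x % u.length) (by have := Nat.mod_lt x hu'; omega)
    rw [Nat.add_mod_right, ← h2] at h1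
    have e1 : (s.length + (x % u.length + z.length)) % u.length =
        (s.length + (x + z.length)) % u.length := by
      simp [Nat.add_mod]
    have e2 : (s.length + x % u.length) % u.length = (s.length + x) % u.length := by simp
    rwa [e1, e2] at h1
  refine ⟨s.length, fun x => ?_⟩
  have h : u[(s.length + x % z.length) % u.length]? = u[(s.length + x) % u.length]? :=
    hper.map_mod_nat x
  have := Nat.mod_lt x hz'
  rw [← h, hwin _ (by omega), Nat.mod_mod]

end Powers

namespace Block

theorem Valid.pos {m : ℕ} {f : Block} (hf : f.Valid m) : 0 < f.a := by
  unfold Valid at hf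
  omega

theorem Valid.word_ne_nil {m : ℕ} {f : Block} (hf : f.Valid m) : f.word ≠ [] := by
  have := hf.pos
  rw [← List.length_pos_iff, length_word]
  omega

/-- The letters of the periodic sequence generated by `f.word`. -/
def letter (f : Block) (x : ℕ) : ℕ := if x % (f.a + f.b) < f.a then f.lo else f.hi

theorem getElem?_word_mod {f : Block} (hf : 0 < f.a) (x : ℕ) :
    f.word[x % f.word.length]? = some (f.letter x) := by
  have := Nat.mod_lt x (show 0 < f.a + f.b by omega)
  rw [length_word, word, letter]
  split_ifs with h
  · rw [List.getElem?_append_left (by simpa using h)]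
    simp [h]
  · rw [List.getElem?_append_right (by simpa using h), List.getElem?_replicate, if_pos]
    simp
    omega

theorem letter_mul_add (f : Block) (k x : ℕ) : f.letter ((f.a + f.b) * k + x) = f.letter x := by
  simp [letter]

theorem Valid.letter_mem {m : ℕ} {f : Block} (hf : f.Valid m) (x : ℕ) :
    f.lo ≤ f.letter x ∧ f.letter x ≤ f.hi := by
  unfold Valid at hf
  unfold letter
  split_ifs <;> omega

theorem letter_of_lt {f : Block} {i : ℕ} (hi : i < f.a) :
    f.letter i = f.lo := by
  rw [letter, Nat.mod_eq_of_lt (by omega), if_pos hi]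

theorem letter_add_of_lt {f : Block} {i : ℕ} (hi : i < f.b) :
    f.letter (f.a + i) = f.hi := by
  rw [letter, Nat.mod_eq_of_lt (by omega), if_neg (by omega)]

theorem Valid.letter_length_sub_one {m : ℕ} {f : Block} (hf : f.Valid m) :
    f.letter (f.a + f.b - 1) = f.hi := by
  unfold Valid at hf
  rw [letter, Nat.mod_eq_of_lt (by omega)]
  split_ifs <;> omega

/-- Every position of a shifted sequence of letters reappears beyond the shift. -/
theorem exists_letter_eq {f g : Block} (hg : 0 < g.a) {o o' : ℕ}
    (h : ∀ x, f.letter (o + x) = g.letter (o' + x)) :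
    ∃ z, ∀ i, f.letter (z + i) = g.letter i := by
  refine ⟨o + ((g.a + g.b) * o' - o'), fun i => ?_⟩
  have : o' ≤ (g.a + g.b) * o' := Nat.le_mul_of_pos_left _ (by omega)
  rw [← letter_mul_add g o' i, add_assoc, h]
  congr 1
  omega

theorem le_of_letter_eq {m : ℕ} {f g : Block} (hf : f.Valid m) (hlo : f.lo = g.lo)
    (hhi : f.hi = g.hi) (hlt : f.lo < f.hi) {z : ℕ} (h : ∀ i, f.letter (z + i) = g.letter i) : g.a ≤ f.a ∧ g.b ≤ f.b := by
  have hb : 0 < f.b := by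
    unfold Valid at hf
    omega
  have ha := hf.pos
  constructor
  · by_contra! hlt
    have h1 := h (f.a - z % (f.a + f.b))
    have := Nat.mod_lt z (show 0 < f.a + f.b by omega)
    rw [letter_of_lt (f := g) (by omega), letter, ← Nat.mod_add_mod,
      Nat.mod_eq_of_lt (by omega), if_neg (by omega)] at h1
    omega
  · by_contra! hlt
    have := Nat.mod_lt (z + g.a) (show 0 < f.a + f.b by omega)
    rcases lt_or_ge ((z + g.a) % (f.a + f.b)) f.a with hj | hj
    · have h1 := h (g.a + 0)
      rw [letter_add_of_lt (f := g) (by omega), letter, ← add_assoc, add_zero, if_pos hj] at h1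
      omega
    · have h1 := h (g.a + (f.a + f.b - (z + g.a) % (f.a + f.b)))
      rw [letter_add_of_lt (f := g) (by omega), letter, ← add_assoc, ← Nat.mod_add_mod,
        Nat.add_sub_cancel' this.le, Nat.mod_self, if_pos ha] at h1
      omega

theorem eq_of_letter_eq {m : ℕ} {f g : Block} (hf : f.Valid m) (hg : g.Valid m) {o o' : ℕ}
    (h : ∀ x, f.letter (o + x) = g.letter (o' + x)) : f = g := by
  obtain ⟨z, hz⟩ := exists_letter_eq hg.pos h
  obtain ⟨z', hz'⟩ := exists_letter_eq hf.pos fun x => (h x).symm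
  have h1 := hf.letter_mem (z + 0)
  have h2 := hf.letter_mem (z + (g.a + g.b - 1))
  have h3 := hg.letter_mem (z' + 0)
  have h4 := hg.letter_mem (z' + (f.a + f.b - 1))
  rw [hz, letter_of_lt hg.pos] at h1
  rw [hz, hg.letter_length_sub_one] at h2
  rw [hz', letter_of_lt hf.pos] at h3
  rw [hz', hf.letter_length_sub_one] at h4
  have hlo : f.lo = g.lo := by omega
  have hhi : f.hi = g.hi := by omega
  by_cases hs : f.lo = f.hi
  · unfold Valid at hf hg
    ext <;> omega
  have hlt : f.lo < f.hi := by omega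
  have hle := le_of_letter_eq hf hlo hhi hlt hz
  have hle' := le_of_letter_eq hg hlo.symm hhi.symm (by omega) hz'
  ext <;> omega

theorem eq_of_wpow_infix {m : ℕ} {f g : Block} (hf : f.Valid m) (hg : g.Valid m) {u : List ℕ}
    (hu : u ≠ []) {k M : ℕ} (hM : u.length < M) (h : wpow f.word M <:+: wpow u k)
    (h' : wpow g.word M <:+: wpow u k) : f = g := by
  obtain ⟨o, ho⟩ := exists_shift_of_wpow_infix hf.word_ne_nil hu hM h
  obtain ⟨o', ho'⟩ := exists_shift_of_wpow_infix hg.word_ne_nil hu hM h'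
  apply eq_of_letter_eq hf hg (o := o') (o' := o)
  intro x
  have h1 := ho (o' + x)
  have h2 := ho' (o + x)
  rw [getElem?_word_mod hf.pos] at h1
  rw [getElem?_word_mod hg.pos, ← add_assoc, add_comm o' o, add_assoc, h1] at h2
  exact Option.some.inj h2

open Classical in
theorem exists_pairwise_before (S : Finset Block) :
    ∃ L : List Block, L.Pairwise Before ∧ ∀ f, f ∈ L ↔ f ∈ S := by
  have : Std.Total Before := ⟨fun f g => by unfold Before; omega⟩
  have : IsTrans Block Before := ⟨fun f g h => by unfold Before; omega⟩
  refine ⟨S.toList.insertionSort Before, List.pairwise_insertionSort _ _, fun f => ?_⟩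
  rw [List.mem_insertionSort, Finset.mem_toList]

theorem wpow_word (f : Block) (K : ℕ) : wpow f.word K = cat (List.replicate K f) := by
  induction K with
  | zero => rfl
  | succ K ih => rw [wpow, ih, List.replicate_succ, cat_cons]

/-- A set of valid blocks gives a word that is not `m`-divisible and contains high powers of all
the words of these blocks. -/
theorem exists_not_nDivisible {m : ℕ} (hm : 2 ≤ m) (S : Finset Block) (hS : ∀ f ∈ S, f.Valid m)
    (K : ℕ) : ∃ W : List ℕ, ¬ NDivisible W m ∧ (∀ f ∈ S, wpow f.word K <:+: W) ∧
      ∀ x ∈ W, ∃ f ∈ S, x ≤ f.hi := by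
  obtain ⟨L, hp, hmem⟩ := exists_pairwise_before S
  refine ⟨cat (L.flatMap (List.replicate K)), not_nDivisible_cat hm _ ?_ ?_, ?_, ?_⟩
  · rw [List.pairwise_flatMap]
    refine ⟨fun f _ => ?_, hp.imp fun hfg x hx y hy => ?_⟩
    · rw [List.pairwise_replicate]
      exact Or.inr (Before.refl f)
    · rwa [List.eq_of_mem_replicate hx, List.eq_of_mem_replicate hy]
  · intro f hf
    obtain ⟨g, hg, hfg⟩ := List.mem_flatMap.1 hf
    rw [List.eq_of_mem_replicate hfg]
    exact hS g ((hmem g).1 hg)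
  · intro f hf
    obtain ⟨s, t, rfl⟩ := List.append_of_mem ((hmem f).2 hf)
    rw [wpow_word]
    exact ⟨cat (s.flatMap (List.replicate K)), cat (t.flatMap (List.replicate K)), by simp⟩
  · intro x hx
    obtain ⟨f, hf, hx⟩ := List.mem_flatMap.1 hx
    obtain ⟨g, hg, hfg⟩ := List.mem_flatMap.1 hf
    rw [List.eq_of_mem_replicate hfg] at hx
    refine ⟨g, (hmem g).1 hg, ?_⟩
    have := hS g ((hmem g).1 hg)
    unfold Valid at this
    rcases List.mem_append.1 hx with h | h <;>
      exact (List.eq_of_mem_replicate h).trans_le (by omega)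

/-- A word containing high powers of all the words of a set of valid blocks is not a product of
few powers. -/
theorem card_le_of_eq_flatten {m H : ℕ} (hm : 0 < m) {S : Finset Block} (hS : ∀ f ∈ S, f.Valid m)
    {W : List ℕ} (hW : ∀ f ∈ S, wpow f.word (m * (H + 1)) <:+: W) {r : ℕ} (hr : r ≤ H)
    (u : Fin r → List ℕ) (k : Fin r → ℕ) (hu : ∀ i, u i ≠ [] ∧ (u i).length < m)
    (h : W = (List.ofFn fun i => wpow (u i) (k i)).flatten) : S.card ≤ r := by
  have hex (f : S) : ∃ i : Fin r, wpow f.1.word m <:+: wpow (u i) (k i) := by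
    obtain ⟨e, he, hi⟩ := exists_wpow_infix_of_infix_flatten (hS f f.2).word_ne_nil hm
      (List.ofFn fun i => wpow (u i) (k i)) (K := m * (H + 1))
      (by rw [List.length_ofFn]; gcongr) (h ▸ hW f f.2)
    obtain ⟨i, rfl⟩ := List.mem_ofFn.1 he
    exact ⟨i, hi⟩
  choose φ hφ using hex
  have hinj : Function.Injective φ := fun f g hfg =>
    Subtype.ext (eq_of_wpow_infix (hS f f.2) (hS g g.2) (hu (φ f)).1 (hu (φ f)).2 (hφ f)
      (hfg ▸ hφ g))
  simpa using Fintype.card_le_of_injective φ hinj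

theorem exists_finset_valid (l m : ℕ) (hl : 2 ≤ l) (hm : 2 ≤ m) :
    ∃ S : Finset Block, (∀ f ∈ S, f.Valid m ∧ f.hi < l) ∧ (l - 1) * m ^ 2 / 4 < S.card := by
  classical
  let I : Finset (ℕ ⊕ (ℕ × Σ _ : ℕ, ℕ) ⊕ ℕ) :=
    (Finset.range l).disjSum
      ((Finset.range (l - 1) ×ˢ (Finset.range (m - 1)).sigma Finset.range).disjSum
        (Finset.range (if 3 ≤ m then l - 2 else 0)))
  let φ : ℕ ⊕ (ℕ × Σ _ : ℕ, ℕ) ⊕ ℕ → Block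
    | .inl x => ⟨x, x, 1, 0⟩
    | .inr (.inl (x, ⟨i, j⟩)) => ⟨x, x + 1, j + 1, i - j⟩
    | .inr (.inr x) => ⟨x, x + 2, 1, 1⟩
  have hφ : Set.InjOn φ I := by
    rintro (x | ⟨x, i, j⟩ | x) hx (y | ⟨y, i', j'⟩ | y) hy hxy <;>
      simp [φ, I] at hx hy hxy ⊢ <;> omega
  refine ⟨I.image φ, fun f hf => ?_, ?_⟩
  · obtain ⟨x, hx, rfl⟩ := Finset.mem_image.1 hf
    rcases x with x | ⟨x, i, j⟩ | x <;> (simp [I] at hx; simp [φ, Valid])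
    · exact hx
    · omega
    · split_ifs at hx <;> omega
  · rw [Finset.card_image_of_injOn hφ]
    have hsum := Finset.sum_range_id_mul_two (m - 1)
    simp only [I, Finset.card_disjSum, Finset.card_product, Finset.card_sigma, Finset.card_range]
    generalize ∑ i ∈ Finset.range (m - 1), i = T at *
    obtain ⟨n, rfl⟩ := Nat.exists_eq_add_of_le hl
    obtain ⟨k, rfl⟩ := Nat.exists_eq_add_of_le hm
    rw [show 2 + k - 1 = k + 1 by omega, Nat.add_sub_cancel] at hsum
    rw [show 2 + n - 1 = n + 1 by omega, show 2 + n - 2 = n by omega,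
      Nat.div_lt_iff_lt_mul (by norm_num)]
    rcases k with _ | _ | k
    · simp
      omega
    · obtain rfl : T = 1 := by omega
      simp
      omega
    · nlinarith [Nat.zero_le (if 3 ≤ 2 + (k + 1 + 1) then n else 0), Nat.zero_le (n * k),
        Nat.zero_le (n * k * k)]

end Block

theorem WordGt.map_val {l : ℕ} {u v : List (Fin l)} (h : WordGt u v) :
    WordGt (u.map Fin.val) (v.map Fin.val) := by
  refine ⟨?_, fun hp => h.2 ?_⟩
  · obtain ⟨hlex, -⟩ := h
    induction hlex with
    | nil => exact List.Lex.nil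
    | rel h => exact List.Lex.rel h
    | cons _ ih => exact List.Lex.cons ih
  · exact (List.prefix_map_iff_of_injective Fin.val_injective).1 hp

theorem NDivisible.map_val {l n : ℕ} {W : List (Fin l)} (h : NDivisible W n) :
    NDivisible (W.map Fin.val) n := by
  obtain ⟨W₀, f, rfl, hne, hgt⟩ := h
  refine ⟨W₀.map Fin.val, fun i => (f i).map Fin.val, ?_, fun i => by simpa using hne i,
    fun i j hij => (hgt i j hij).map_val⟩
  rw [List.map_append, List.map_flatten, List.map_ofFn]
  rfl

/-- The height of the set of non-`m`-divisible words over an `l`-letter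
alphabet (`l ≥ 2`, `m ≥ 2`) with respect to the set of words of length at most
`m−1` is at least `(l−1)m²/4 + 1`: for every `H ≤ (l−1)m²/4` there is a
non-`m`-divisible word that is not a product of at most `H` powers of words of
length at most `m−1`. -/
theorem height_lower_bound (l m : ℕ) (hl : 2 ≤ l) (hm : 2 ≤ m) (H : ℕ)
    (hH : H ≤ (l - 1) * m ^ 2 / 4) :
    ∃ W : List (Fin l), W ≠ [] ∧ ¬ NDivisible W m ∧
      ¬ ∃ (r : ℕ) (u : Fin r → List (Fin l)) (k : Fin r → ℕ),
          r ≤ H ∧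
          (∀ i, u i ≠ [] ∧ (u i).length ≤ m - 1 ∧ 1 ≤ k i) ∧
          W = (List.ofFn fun i => wpow (u i) (k i)).flatten := by
  obtain ⟨S, hS, hcard⟩ := Block.exists_finset_valid l m hl hm
  obtain ⟨V, hV, hpow, hlt⟩ :=
    Block.exists_not_nDivisible hm S (fun f hf => (hS f hf).1) (m * (H + 1))
  obtain ⟨W, rfl⟩ : ∃ W : List (Fin l), W.map Fin.val = V := by
    refine ⟨V.pmap Fin.mk fun x hx => ?_, by simp [List.map_pmap]⟩
    obtain ⟨f, hf, hxf⟩ := hlt x hx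
    exact hxf.trans_lt (hS f hf).2
  have hfac : ¬ ∃ (r : ℕ) (u : Fin r → List (Fin l)) (k : Fin r → ℕ),
      r ≤ H ∧ (∀ i, u i ≠ [] ∧ (u i).length ≤ m - 1 ∧ 1 ≤ k i) ∧
        W = (List.ofFn fun i => wpow (u i) (k i)).flatten := by
    rintro ⟨r, u, k, hr, hu, rfl⟩
    have := Block.card_le_of_eq_flatten (by omega) (fun f hf => (hS f hf).1) hpow hr
      (fun i => (u i).map Fin.val) k
      (fun i => ⟨by simpa using (hu i).1, by have := (hu i).2.1; rw [List.length_map]; omega⟩)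
      (by simp only [List.map_flatten, List.map_ofFn, ← map_wpow]; rfl)
    omega
  refine ⟨W, ?_, fun h => hV h.map_val, hfac⟩
  rintro rfl
  exact hfac ⟨0, Fin.elim0, Fin.elim0, Nat.zero_le _, fun i => i.elim0, by simp⟩
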